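/- arXiv:1802.08297 — 2 statements merged into one kernel-verified Lean document; each statement's English description precedes it below -/
import Mathlib

section
/- Let d ≥ 3 be an odd integer and let E ⊆ F_q^d. If |E| ≥ 6·q^{d/2}, then {0} ∪ F_q^+ ⊆ Δ(E)/Δ(E), where F_q^+ denotes the set of nonzero quadratic residues (nonzero squares) of F_q. -/
open Finset

def nrm {F : Type} [Field F] {d : ℕ} (x : Fin d → F) : F := ∑ i, x i ^ 2

noncomputable def ft {F : Type} [Field F] [Fintype F] (d : ℕ) (χ : AddChar F ℂ)
    (f : (Fin d → F) → ℂ) (m : Fin d → F) : ℂ :=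
  (Fintype.card F : ℂ) ^ (-(d : ℤ)) * ∑ x : Fin d → F, χ (-(∑ i, x i * m i)) * f x

noncomputable def sphereFT {F : Type} [Field F] [Fintype F] [DecidableEq F] (d : ℕ)
    (χ : AddChar F ℂ) (t : F) (m : Fin d → F) : ℂ :=
  ft d χ (fun x => if nrm x = t then 1 else 0) m

noncomputable def eta (F : Type) [Field F] [Fintype F] [DecidableEq F] (s : F) : ℂ :=
  ((quadraticChar F s : ℤ) : ℂ)

noncomputable def gSum (F : Type) [Field F] [Fintype F] [DecidableEq F] (χ : AddChar F ℂ) : ℂ :=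
  ∑ s ∈ Finset.univ.filter (fun s : F => s ≠ 0), eta F s * χ s

def nu {F : Type} [Field F] [Fintype F] [DecidableEq F] {d : ℕ}
    (E : Finset (Fin d → F)) (t : F) : ℕ :=
  ((E ×ˢ E).filter (fun p => nrm (p.1 - p.2) = t)).card

def distSet {F : Type} [Field F] {d : ℕ} (E : Finset (Fin d → F)) : Set F :=
  {t | ∃ x ∈ E, ∃ y ∈ E, nrm (x - y) = t}

def quotSet {F : Type} [Field F] {d : ℕ} (E : Finset (Fin d → F)) : Set F :=
  {r | ∃ a ∈ distSet E, ∃ b ∈ distSet E, b ≠ 0 ∧ r = a / b}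

def sphereCard (F : Type) [Field F] [Fintype F] [DecidableEq F] (d : ℕ) (t : F) : ℕ :=
  (Finset.univ.filter (fun x : Fin d → F => nrm x = t)).card

open AddChar

/-- The quadratic character of a finite field as a complex-valued multiplicative character. -/
noncomputable def quadraticCharComplex (F : Type) [Field F] [Fintype F] [DecidableEq F] :
    MulChar F ℂ :=
  (quadraticChar F).ringHomComp (Int.castRingHom ℂ)

section

variable {F : Type} [Field F] [Fintype F] [DecidableEq F] {d : ℕ}

omit [Fintype F] [DecidableEq F] in
lemma four_ne_zero_of_ringChar_ne_two (h2 : ringChar F ≠ 2) : (4 : F) ≠ 0 := by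
  have h : (4 : F) = 2 * 2 := by norm_num
  rw [h]
  exact mul_ne_zero (Ring.two_ne_zero h2) (Ring.two_ne_zero h2)

lemma quadraticCharComplex_apply (s : F) :
    quadraticCharComplex F s = ((quadraticChar F s : ℤ) : ℂ) := rfl

lemma quadraticCharComplex_isQuadratic : (quadraticCharComplex F).IsQuadratic :=
  (quadraticChar_isQuadratic F).comp _

lemma quadraticCharComplex_ne_one (h2 : ringChar F ≠ 2) : quadraticCharComplex F ≠ 1 := by
  obtain ⟨a, ha⟩ := quadraticChar_exists_neg_one h2
  intro h
  have ha0 : a ≠ 0 := by rintro rfl; simp at ha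
  have := quadraticCharComplex_apply a
  rw [h, ha, MulChar.one_apply (isUnit_iff_ne_zero.2 ha0)] at this
  norm_num at this

lemma quadraticCharComplex_sq {s : F} (hs : s ≠ 0) : quadraticCharComplex F s ^ 2 = 1 := by
  rw [quadraticCharComplex_apply]
  exact_mod_cast quadraticChar_sq_one hs

lemma norm_quadraticCharComplex {s : F} (hs : s ≠ 0) : ‖quadraticCharComplex F s‖ = 1 := by
  have h := congrArg norm (quadraticCharComplex_sq hs)
  rw [norm_pow, norm_one] at h
  exact (pow_eq_one_iff_of_nonneg (norm_nonneg _) two_ne_zero).1 h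

lemma norm_quadraticCharComplex_le (s : F) : ‖quadraticCharComplex F s‖ ≤ 1 := by
  rcases eq_or_ne s 0 with rfl | hs
  · rw [MulChar.map_zero, norm_zero]
    exact zero_le_one
  · exact (norm_quadraticCharComplex hs).le

lemma quadraticCharComplex_inv (s : F) : quadraticCharComplex F s⁻¹ = quadraticCharComplex F s := by
  rw [← MulChar.inv_apply', quadraticCharComplex_isQuadratic.inv]

variable {χ : AddChar F ℂ}

lemma norm_gaussSum_quadratic_sq (h2 : ringChar F ≠ 2) (hχ : χ.IsPrimitive) :
    ‖gaussSum (quadraticCharComplex F) χ‖ ^ 2 = Fintype.card F := by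
  have h := gaussSum_sq (quadraticCharComplex_ne_one h2) quadraticCharComplex_isQuadratic hχ
  have h := congrArg norm h
  rwa [norm_pow, norm_mul, norm_quadraticCharComplex (neg_ne_zero.2 one_ne_zero), one_mul,
    Complex.norm_natCast] at h

lemma sum_quadraticCharComplex_mul (h2 : ringChar F ≠ 2) (s : F) :
    ∑ t, quadraticCharComplex F t * χ (t * s)
      = quadraticCharComplex F s * gaussSum (quadraticCharComplex F) χ := by
  rcases eq_or_ne s 0 with rfl | hs
  · rw [MulChar.map_zero]
    simpa using MulChar.sum_eq_zero_of_ne_one (quadraticCharComplex_ne_one h2)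
  · have h := gaussSum_mulShift_eq (quadraticCharComplex F) χ (Units.mk0 s hs)
    rw [quadraticCharComplex_isQuadratic.inv] at h
    simpa [gaussSum, mulShift_apply, mul_comm] using h

/-- The one-dimensional quadratic Gauss sum. -/
lemma sum_addChar_mul_sq (h2 : ringChar F ≠ 2) (hχ : χ.IsPrimitive) {s : F} (hs : s ≠ 0) :
    ∑ v, χ (s * v ^ 2) = quadraticCharComplex F s * gaussSum (quadraticCharComplex F) χ := by
  have key : ∑ v, χ (s * v ^ 2) = ∑ t, (quadraticCharComplex F t + 1) * χ (t * s) := by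
    rw [← Finset.sum_fiberwise (s := univ) (g := fun v : F => v ^ 2)]
    refine Finset.sum_congr rfl fun t _ => ?_
    have hc : ((univ.filter fun v : F => v ^ 2 = t).card : ℂ) = quadraticCharComplex F t + 1 := by
      rw [quadraticCharComplex_apply]
      have := quadraticChar_card_sqrts h2 t
      rw [Set.toFinset_ofPred] at this
      exact_mod_cast this
    rw [← hc, ← nsmul_eq_mul, ← Finset.sum_const]
    refine Finset.sum_congr rfl fun v hv => ?_
    rw [← (Finset.mem_filter.1 hv).2, mul_comm]
  rw [key]
  simp_rw [add_mul, one_mul]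
  rw [Finset.sum_add_distrib, sum_quadraticCharComplex_mul h2, sum_mulShift _ hχ, if_neg hs]
  simp

lemma sum_addChar_quadratic (h2 : ringChar F ≠ 2) (hχ : χ.IsPrimitive) {s : F} (hs : s ≠ 0)
    (b : F) :
    ∑ v, χ (s * v ^ 2 + b * v) = quadraticCharComplex F s * gaussSum (quadraticCharComplex F) χ
      * χ (-(4 * s)⁻¹ * b ^ 2) := by
  have h20 : (2 : F) ≠ 0 := Ring.two_ne_zero h2
  have h40 : (4 : F) ≠ 0 := four_ne_zero_of_ringChar_ne_two h2
  rw [← sum_addChar_mul_sq h2 hχ hs, Finset.sum_mul,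
    ← (Equiv.subRight (b / (2 * s))).sum_comp]
  refine Finset.sum_congr rfl fun v _ => ?_
  rw [← map_add_eq_mul]
  congr 1
  simp only [Equiv.subRight_apply]
  field_simp
  ring

omit [Fintype F] [DecidableEq F] in
lemma addChar_sum_eq_prod {ι : Type*} (S : Finset ι) (f : ι → F) :
    χ (∑ i ∈ S, f i) = ∏ i ∈ S, χ (f i) := by
  induction S using Finset.cons_induction with
  | empty => simp
  | cons i S hi ih => rw [Finset.sum_cons, Finset.prod_cons, map_add_eq_mul, ih]

lemma sum_addChar_quadratic_pi (h2 : ringChar F ≠ 2) (hχ : χ.IsPrimitive) {s : F} (hs : s ≠ 0)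
    (b : Fin d → F) :
    ∑ v : Fin d → F, χ (s * nrm v + ∑ i, b i * v i)
      = (quadraticCharComplex F s * gaussSum (quadraticCharComplex F) χ) ^ d
        * χ (-(4 * s)⁻¹ * nrm b) := by
  have h (v : Fin d → F) : χ (s * nrm v + ∑ i, b i * v i) = ∏ i, χ (s * v i ^ 2 + b i * v i) := by
    rw [nrm, Finset.mul_sum, ← Finset.sum_add_distrib, addChar_sum_eq_prod]
  simp_rw [h]
  rw [← Fintype.prod_sum fun i (t : F) => χ (s * t ^ 2 + b i * t)]
  simp_rw [sum_addChar_quadratic h2 hχ hs]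
  rw [Finset.prod_mul_distrib, Finset.prod_const, Finset.card_univ, Fintype.card_fin,
    ← addChar_sum_eq_prod, ← Finset.mul_sum, nrm]

lemma sum_addChar_dot (hχ : χ.IsPrimitive) (b : Fin d → F) :
    ∑ v : Fin d → F, χ (∑ i, b i * v i) = if b = 0 then (Fintype.card F : ℂ) ^ d else 0 := by
  have h (v : Fin d → F) : χ (∑ i, b i * v i) = ∏ i, χ (v i * b i) := by
    rw [addChar_sum_eq_prod]; simp_rw [mul_comm]
  simp_rw [h]
  rw [← Fintype.prod_sum fun i (t : F) => χ (t * b i)]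
  simp_rw [sum_mulShift _ hχ]
  split_ifs with hb
  · simp [hb]
  · obtain ⟨i, hi⟩ := Function.ne_iff.1 hb
    exact Finset.prod_eq_zero (Finset.mem_univ i) (by simpa using hi)

/-- The exponential sum over the distances of `E`, with multiplicity. -/
noncomputable def distExpSum (χ : AddChar F ℂ) (E : Finset (Fin d → F)) (s : F) : ℂ :=
  ∑ p ∈ E ×ˢ E, χ (s * nrm (p.1 - p.2))

/-- The squared modulus of the unnormalised Fourier transform of the indicator of `E`. -/
noncomputable def powerSpectrum (χ : AddChar F ℂ) (E : Finset (Fin d → F)) (m : Fin d → F) : ℝ :=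
  ‖∑ x ∈ E, χ (∑ i, x i * m i)‖ ^ 2

/-- The exponential sum over the norms of all frequencies, weighted by the power spectrum. -/
noncomputable def spectralExpSum (χ : AddChar F ℂ) (E : Finset (Fin d → F)) (u : F) : ℂ :=
  ∑ m, (powerSpectrum χ E m : ℂ) * χ (u * nrm m)

variable (E : Finset (Fin d → F))

omit [Fintype F] [DecidableEq F] in
lemma powerSpectrum_nonneg (m : Fin d → F) : 0 ≤ powerSpectrum χ E m := by
  unfold powerSpectrum; positivity

omit [DecidableEq F] in
lemma powerSpectrum_eq_sum (m : Fin d → F) :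
    (powerSpectrum χ E m : ℂ) = ∑ p ∈ E ×ˢ E, χ (∑ i, (p.1 - p.2) i * m i) := by
  rw [powerSpectrum, Complex.ofReal_pow, ← Complex.mul_conj', map_sum, Finset.sum_mul_sum,
    Finset.sum_product]
  refine Finset.sum_congr rfl fun x _ => Finset.sum_congr rfl fun y _ => ?_
  rw [← map_neg_eq_conj, ← map_add_eq_mul, ← sub_eq_add_neg, ← Finset.sum_sub_distrib]
  simp [sub_mul]

lemma spectralExpSum_zero (hχ : χ.IsPrimitive) :
    spectralExpSum χ E 0 = (Fintype.card F : ℂ) ^ d * E.card := by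
  simp_rw [spectralExpSum, zero_mul, map_zero_eq_one, mul_one, powerSpectrum_eq_sum]
  rw [Finset.sum_comm]
  simp_rw [sum_addChar_dot hχ]
  rw [Finset.sum_product]
  simp [sub_eq_zero, mul_comm]

lemma sum_powerSpectrum (hχ : χ.IsPrimitive) :
    ∑ m, powerSpectrum χ E m = (Fintype.card F : ℝ) ^ d * E.card := by
  have h := spectralExpSum_zero E hχ
  simp_rw [spectralExpSum, zero_mul, map_zero_eq_one, mul_one] at h
  exact_mod_cast h

lemma spectralExpSum_eq (h2 : ringChar F ≠ 2) (hχ : χ.IsPrimitive) {u : F} (hu : u ≠ 0) :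
    spectralExpSum χ E u = (quadraticCharComplex F u * gaussSum (quadraticCharComplex F) χ) ^ d
      * distExpSum χ E (-(4 * u)⁻¹) := by
  simp_rw [spectralExpSum, powerSpectrum_eq_sum, Finset.sum_mul]
  rw [Finset.sum_comm, distExpSum, Finset.mul_sum]
  refine Finset.sum_congr rfl fun p _ => ?_
  rw [← sum_addChar_quadratic_pi h2 hχ hu]
  refine Finset.sum_congr rfl fun m _ => ?_
  rw [← map_add_eq_mul, add_comm]

omit [Fintype F] [DecidableEq F] in
lemma distExpSum_zero : distExpSum χ E 0 = (E.card : ℂ) ^ 2 := by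
  simp [distExpSum, sq]

/-- Pairs of elements with equal `f`-value and `g`-value are counted by correlating the
corresponding exponential sums. -/
lemma sum_mul_conj_expSum (hχ : χ.IsPrimitive) {ι κ : Type*} (S : Finset ι) (T : Finset κ)
    (w : ι → ℂ) (z : κ → ℝ) (f : ι → F) (g : κ → F) :
    ∑ s, (∑ i ∈ S, w i * χ (s * f i)) * (starRingEnd ℂ) (∑ j ∈ T, (z j : ℂ) * χ (s * g j))
      = Fintype.card F * ∑ i ∈ S, ∑ j ∈ T, if f i = g j then w i * z j else 0 := by
  simp_rw [map_sum, Finset.sum_mul_sum]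
  rw [Finset.sum_comm, Finset.mul_sum]
  refine Finset.sum_congr rfl fun i _ => ?_
  rw [Finset.sum_comm, Finset.mul_sum]
  refine Finset.sum_congr rfl fun j _ => ?_
  have h (s : F) : w i * χ (s * f i) * (starRingEnd ℂ) ((z j : ℂ) * χ (s * g j))
      = w i * z j * χ (s * (f i - g j)) := by
    rw [map_mul (starRingEnd ℂ), Complex.conj_ofReal, ← map_neg_eq_conj, mul_sub, sub_eq_add_neg, map_add_eq_mul]
    ring
  simp_rw [h]
  rw [← Finset.mul_sum, sum_mulShift _ hχ]
  simp only [sub_eq_zero]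
  split_ifs <;> push_cast <;> ring

/-- The number of quadruples in `E` whose two distances have ratio `a`. -/
def ratioCount (E : Finset (Fin d → F)) (a : F) : ℕ :=
  (((E ×ˢ E) ×ˢ (E ×ˢ E)).filter
    fun r => nrm (r.1.1 - r.1.2) = a * nrm (r.2.1 - r.2.2)).card

lemma card_mul_ratioCount (hχ : χ.IsPrimitive) (a : F) :
    (Fintype.card F * ratioCount E a : ℂ)
      = ∑ s, distExpSum χ E s * (starRingEnd ℂ) (distExpSum χ E (a * s)) := by
  have h := sum_mul_conj_expSum hχ (E ×ˢ E) (E ×ˢ E) (fun _ => 1) (fun _ => 1)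
    (fun p => nrm (p.1 - p.2)) (fun p => a * nrm (p.1 - p.2))
  simp only [Complex.ofReal_one, one_mul] at h
  have h' : (ratioCount E a : ℂ) = ∑ p ∈ E ×ˢ E, ∑ r ∈ E ×ˢ E,
      if nrm (p.1 - p.2) = a * nrm (r.1 - r.2) then (1 : ℂ) else 0 := by
    rw [ratioCount, ← Finset.sum_boole, Finset.sum_product]
  rw [h', ← h]
  simp only [distExpSum]
  refine Finset.sum_congr rfl fun s _ => ?_
  congr 3
  ext p
  rw [mul_left_comm, mul_assoc]

/-- Substituting `s = -(4 * u)⁻¹` permutes the nonzero elements. -/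
lemma sum_ne_zero_neg_inv {M : Type*} [AddCommMonoid M] (h2 : ringChar F ≠ 2) (f : F → M) :
    ∑ u ∈ univ.erase (0 : F), f (-(4 * u)⁻¹) = ∑ s ∈ univ.erase (0 : F), f s := by
  have h4 : (4 : F) ≠ 0 := four_ne_zero_of_ringChar_ne_two h2
  refine Finset.sum_nbij' (fun u => -(4 * u)⁻¹) (fun s => -(4 * s)⁻¹) ?_ ?_ ?_ ?_ ?_
  · simp [h4]
  · simp [h4]
  · intro u _
    field_simp
  · intro u _
    field_simp
  · simp

lemma spectralExpSum_mul_conj (h2 : ringChar F ≠ 2) (hχ : χ.IsPrimitive) {a u : F} (ha : a ≠ 0)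
    (hsq : IsSquare a) (hu : u ≠ 0) :
    spectralExpSum χ E u * (starRingEnd ℂ) (spectralExpSum χ E (a⁻¹ * u))
      = (Fintype.card F : ℂ) ^ d * (distExpSum χ E (-(4 * u)⁻¹)
        * (starRingEnd ℂ) (distExpSum χ E (a * -(4 * u)⁻¹))) := by
  have hη : quadraticCharComplex F (a⁻¹ * u) = quadraticCharComplex F u := by
    obtain ⟨c, rfl⟩ := hsq
    have hc : c ≠ 0 := left_ne_zero_of_mul ha
    rw [map_mul, quadraticCharComplex_inv, map_mul, ← sq, quadraticCharComplex_sq hc, one_mul]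
  have hs : -(4 * (a⁻¹ * u))⁻¹ = a * -(4 * u)⁻¹ := by
    simp only [mul_inv, inv_inv]
    ring
  rw [spectralExpSum_eq E h2 hχ hu, spectralExpSum_eq E h2 hχ (mul_ne_zero (inv_ne_zero ha) hu),
    hη, hs, map_mul, mul_mul_mul_comm, Complex.mul_conj', norm_pow, norm_mul,
    norm_quadraticCharComplex hu, one_mul]
  congr 1
  rw [← Complex.ofReal_pow, ← pow_mul, mul_comm d, pow_mul, norm_gaussSum_quadratic_sq h2 hχ]
  push_cast
  rfl

lemma le_card_mul_ratioCount (h2 : ringChar F ≠ 2) (hχ : χ.IsPrimitive) {a : F} (ha : a ≠ 0)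
    (hsq : IsSquare a) :
    (E.card : ℝ) ^ 4 - (Fintype.card F : ℝ) ^ d * (E.card : ℝ) ^ 2
      ≤ Fintype.card F * ratioCount E a := by
  set q := Fintype.card F with hq
  have hq0 : 0 < (q : ℝ) := by exact_mod_cast Fintype.card_pos
  obtain ⟨P, hP0, hP⟩ : ∃ P : ℝ, 0 ≤ P ∧
      ∑ u, spectralExpSum χ E u * (starRingEnd ℂ) (spectralExpSum χ E (a⁻¹ * u)) = P := by
    have h := sum_mul_conj_expSum hχ univ univ (fun m => (powerSpectrum χ E m : ℂ))
      (powerSpectrum χ E) nrm (fun m => a⁻¹ * nrm m)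
    refine ⟨q * ∑ m, ∑ n, if nrm m = a⁻¹ * nrm n then
      powerSpectrum χ E m * powerSpectrum χ E n else 0, ?_, ?_⟩
    · refine mul_nonneg hq0.le (Finset.sum_nonneg fun m _ => Finset.sum_nonneg fun n _ => ?_)
      split_ifs
      exacts [mul_nonneg (powerSpectrum_nonneg E m) (powerSpectrum_nonneg E n), le_rfl]
    · push_cast [apply_ite Complex.ofReal]
      rw [← h]
      refine Finset.sum_congr rfl fun u _ => ?_
      simp only [spectralExpSum]
      congr 3
      ext m
      rw [mul_left_comm, mul_assoc]
  have hmain : (q : ℝ) ^ d * (q * ratioCount E a)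
      = (q : ℝ) ^ d * (E.card : ℝ) ^ 4 + (P - ((q : ℝ) ^ d * E.card) ^ 2) := by
    rw [← Finset.add_sum_erase _ _ (Finset.mem_univ 0), mul_zero, spectralExpSum_zero E hχ,
      Finset.sum_congr rfl fun u hu =>
        spectralExpSum_mul_conj E h2 hχ ha hsq (Finset.ne_of_mem_erase hu),
      ← Finset.mul_sum, sum_ne_zero_neg_inv h2
        (fun s => distExpSum χ E s * (starRingEnd ℂ) (distExpSum χ E (a * s)))] at hP
    have hN := card_mul_ratioCount E hχ a
    rw [← Finset.add_sum_erase _ _ (Finset.mem_univ 0), mul_zero, distExpSum_zero] at hN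
    simp only [map_mul, map_pow, Complex.conj_natCast] at hP hN
    have : (q : ℂ) ^ d * (q * ratioCount E a)
        = (q : ℂ) ^ d * (E.card : ℂ) ^ 4 + (P - ((q : ℂ) ^ d * E.card) ^ 2) := by
      rw [hN, ← hP]
      ring
    exact_mod_cast this
  have hqd : 0 < (q : ℝ) ^ d := pow_pos hq0 d
  refine le_of_mul_le_mul_left ?_ hqd
  rw [hmain]
  linarith

lemma card_mul_nu (hχ : χ.IsPrimitive) :
    (Fintype.card F * nu E 0 : ℂ) = ∑ s, distExpSum χ E s := by
  simp_rw [distExpSum]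
  rw [Finset.sum_comm]
  simp_rw [sum_mulShift _ hχ]
  rw [nu, ← Finset.sum_boole, Finset.mul_sum]
  refine Finset.sum_congr rfl fun p _ => ?_
  split_ifs <;> simp

lemma distExpSum_eq (h2 : ringChar F ≠ 2) (hχ : χ.IsPrimitive) (hd : Odd d) {u : F}
    (hu : u ≠ 0) :
    gaussSum (quadraticCharComplex F) χ ^ d * distExpSum χ E (-(4 * u)⁻¹)
      = quadraticCharComplex F u * spectralExpSum χ E u := by
  have hη : quadraticCharComplex F u ^ d = quadraticCharComplex F u := by
    obtain ⟨k, rfl⟩ := hd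
    rw [pow_succ, pow_mul, quadraticCharComplex_sq hu, one_pow, one_mul]
  rw [spectralExpSum_eq E h2 hχ hu, mul_pow, hη]
  linear_combination (-(gaussSum (quadraticCharComplex F) χ ^ d * distExpSum χ E (-(4 * u)⁻¹)))
    * quadraticCharComplex_sq hu

lemma norm_sum_quadraticCharComplex_mul_spectralExpSum_le (h2 : ringChar F ≠ 2)
    (hχ : χ.IsPrimitive) :
    ‖∑ u, quadraticCharComplex F u * spectralExpSum χ E u‖
      ≤ ‖gaussSum (quadraticCharComplex F) χ‖ * ((Fintype.card F : ℝ) ^ d * E.card) := by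
  simp_rw [spectralExpSum, Finset.mul_sum]
  rw [Finset.sum_comm, ← sum_powerSpectrum E hχ, Finset.mul_sum]
  refine (norm_sum_le _ _).trans (Finset.sum_le_sum fun m _ => ?_)
  simp_rw [mul_left_comm (quadraticCharComplex F _)]
  rw [← Finset.mul_sum, sum_quadraticCharComplex_mul h2, norm_mul, norm_mul, Complex.norm_real,
    Real.norm_of_nonneg (powerSpectrum_nonneg E m), mul_comm]
  refine mul_le_mul_of_nonneg_right ?_ (powerSpectrum_nonneg E m)
  exact mul_le_of_le_one_left (norm_nonneg _) (norm_quadraticCharComplex_le _)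

lemma card_mul_nu_zero_le (h2 : ringChar F ≠ 2) (hχ : χ.IsPrimitive) (hd : Odd d) :
    Fintype.card F * (nu E 0 : ℝ) ≤ (E.card : ℝ) ^ 2
      + ‖gaussSum (quadraticCharComplex F) χ‖ ^ (d + 1) * E.card := by
  set g := gaussSum (quadraticCharComplex F) χ with hg
  have hg2 : ‖g‖ ^ 2 = Fintype.card F := norm_gaussSum_quadratic_sq h2 hχ
  have hg0 : 0 < ‖g‖ := by
    have : 0 < ‖g‖ ^ 2 := by rw [hg2]; exact_mod_cast Fintype.card_pos
    exact lt_of_le_of_ne (norm_nonneg _) fun h => by simp [← h] at this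
  have herr : ‖∑ s ∈ univ.erase (0 : F), distExpSum χ E s‖ ≤ ‖g‖ ^ (d + 1) * E.card := by
    refine le_of_mul_le_mul_left ?_ (pow_pos hg0 d)
    calc ‖g‖ ^ d * ‖∑ s ∈ univ.erase (0 : F), distExpSum χ E s‖
        = ‖∑ u, quadraticCharComplex F u * spectralExpSum χ E u‖ := by
          rw [← norm_pow, ← norm_mul, ← sum_ne_zero_neg_inv h2, Finset.mul_sum,
            ← Finset.add_sum_erase _ _ (Finset.mem_univ (0 : F)), MulChar.map_zero, zero_mul,
            zero_add]
          exact congrArg norm (Finset.sum_congr rfl fun u hu =>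
            distExpSum_eq E h2 hχ hd (Finset.ne_of_mem_erase hu))
      _ ≤ ‖g‖ * ((Fintype.card F : ℝ) ^ d * E.card) :=
          norm_sum_quadraticCharComplex_mul_spectralExpSum_le E h2 hχ
      _ = ‖g‖ ^ d * (‖g‖ ^ (d + 1) * E.card) := by rw [← hg2]; ring
  have h := congrArg norm (card_mul_nu E hχ)
  rw [← Finset.add_sum_erase _ _ (Finset.mem_univ 0), distExpSum_zero, norm_mul,
    Complex.norm_natCast, Complex.norm_natCast] at h
  rw [h]
  refine (norm_add_le _ _).trans (add_le_add ?_ herr)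
  simp

end

lemma exists_ratio {F : Type} [Field F] [Fintype F] [DecidableEq F] {d : ℕ}
    (E : Finset (Fin d → F)) {a : F} (h : nu E 0 ^ 2 < ratioCount E a) :
    ∃ t ∈ distSet E, t ≠ 0 ∧ a * t ∈ distSet E := by
  by_contra! H
  refine h.not_ge ?_
  rw [sq, nu, ← Finset.card_product]
  refine Finset.card_le_card fun r hr => ?_
  simp only [Finset.mem_filter, Finset.mem_product] at hr ⊢
  obtain ⟨⟨⟨h1, h2⟩, h3, h4⟩, h5⟩ := hr
  have h0 : nrm (r.2.1 - r.2.2) = 0 := by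
    by_contra hne
    exact H _ ⟨_, h3, _, h4, rfl⟩ hne ⟨_, h1, _, h2, h5⟩
  rw [h0, mul_zero] at h5
  exact ⟨⟨⟨h1, h2⟩, h5⟩, ⟨h3, h4⟩, h0⟩

lemma nu_zero_sq_lt_ratioCount {F : Type} [Field F] [Fintype F] [DecidableEq F] {d : ℕ}
    (E : Finset (Fin d → F)) (hq : Odd (Fintype.card F)) (hd : Odd d)
    (hE : 36 * (Fintype.card F : ℝ) ^ d ≤ (E.card : ℝ) ^ 2) {a : F} (ha : a ≠ 0)
    (hsq : IsSquare a) : nu E 0 ^ 2 < ratioCount E a := by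
  have h2 : ringChar F ≠ 2 := fun h =>
    Nat.not_even_iff_odd.2 hq (Nat.even_iff.2 (FiniteField.even_card_iff_char_two.1 h))
  have hχ := FiniteField.primitiveChar_to_Complex_isPrimitive F
  have hlow := le_card_mul_ratioCount E h2 hχ ha hsq
  have hup := card_mul_nu_zero_le E h2 hχ hd
  have hg2 := norm_gaussSum_quadratic_sq h2 hχ
  set r := ‖gaussSum (quadraticCharComplex F) (FiniteField.primitiveChar_to_Complex F)‖
  have hr0 : 0 ≤ r := norm_nonneg _
  have hq3 : (3 : ℝ) ≤ Fintype.card F := by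
    have h1 := Fintype.one_lt_card (α := F)
    have : 3 ≤ Fintype.card F := by
      obtain ⟨k, hk⟩ := hq
      omega
    exact_mod_cast this
  rw [← hg2] at hlow hup hE hq3
  set N : ℝ := (ratioCount E a : ℝ)
  set n : ℝ := (nu E 0 : ℝ)
  set e : ℝ := (E.card : ℝ)
  set Q : ℝ := r ^ d with hQ
  have hQ2 : (r ^ 2) ^ d = Q ^ 2 := by rw [hQ]; ring
  rw [hQ2] at hlow hE
  have hr1 : r ^ (d + 1) = r * Q := by rw [hQ]; ring
  rw [hr1] at hup
  have hrpos : 0 < r := by nlinarith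
  have hQ0 : 0 < Q := pow_pos hrpos d
  have he0 : 0 ≤ e := Nat.cast_nonneg _
  have h6 : 6 * Q ≤ e := by nlinarith
  have hn0 : 0 ≤ n := Nat.cast_nonneg _
  have hepos : 0 < e := by linarith
  have h17 : (17 : ℝ) / 10 ≤ r := by nlinarith
  have hup' : r ^ 2 * n ≤ e ^ 2 * (1 + r / 6) := by nlinarith [mul_nonneg hrpos.le he0]
  have hlow' : e ^ 4 * (35 / 36) ≤ r ^ 2 * N := by nlinarith [sq_nonneg e]
  have hsq : (r ^ 2 * n) ^ 2 ≤ (e ^ 2 * (1 + r / 6)) ^ 2 := by gcongr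
  have hkey : (1 + r / 6) ^ 2 < r ^ 2 * (35 / 36) := by nlinarith
  have hlt : r ^ 4 * n ^ 2 < r ^ 4 * N := by
    calc r ^ 4 * n ^ 2 = (r ^ 2 * n) ^ 2 := by ring
      _ ≤ e ^ 4 * (1 + r / 6) ^ 2 := by linarith
      _ < e ^ 4 * (r ^ 2 * (35 / 36)) := by gcongr
      _ = r ^ 2 * (e ^ 4 * (35 / 36)) := by ring
      _ ≤ r ^ 2 * (r ^ 2 * N) := by gcongr
      _ = r ^ 4 * N := by ring
  have : n ^ 2 < N := lt_of_mul_lt_mul_left hlt (by positivity)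
  simp only [n, N] at this
  exact_mod_cast this

theorem quot_dist_odd (F : Type) [Field F] [Fintype F] [DecidableEq F]
    (hq : Odd (Fintype.card F)) (d : ℕ) (hd : 3 ≤ d) (hdo : Odd d)
    (E : Finset (Fin d → F))
    (hE : (6 : ℝ) * (Fintype.card F : ℝ) ^ ((d : ℝ) / 2) ≤ (E.card : ℝ)) :
    ({0} ∪ {a : F | a ≠ 0 ∧ IsSquare a}) ⊆ quotSet E := by
  have hE2 : 36 * (Fintype.card F : ℝ) ^ d ≤ (E.card : ℝ) ^ 2 := by
    calc 36 * (Fintype.card F : ℝ) ^ d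
        = (6 * (Fintype.card F : ℝ) ^ ((d : ℝ) / 2)) ^ 2 := by
          rw [mul_pow, ← Real.rpow_mul_natCast (Nat.cast_nonneg _)]
          norm_num
      _ ≤ (E.card : ℝ) ^ 2 := by gcongr
  have key {a : F} (ha : a ≠ 0) (hsq : IsSquare a) :
      ∃ t ∈ distSet E, t ≠ 0 ∧ a * t ∈ distSet E :=
    exists_ratio E (nu_zero_sq_lt_ratioCount E hq hdo hE2 ha hsq)
  rintro a (rfl | ⟨ha, hsq⟩)
  · obtain ⟨t, ht, ht0, -⟩ := key one_ne_zero ⟨1, (one_mul 1).symm⟩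
    have ⟨x, hx, _⟩ := ht
    exact ⟨0, ⟨x, hx, x, hx, by simp [nrm]⟩, t, ht, ht0, (zero_div t).symm⟩
  · obtain ⟨t, ht, ht0, hat⟩ := key ha hsq
    exact ⟨a * t, hat, t, ht, ht0, (mul_div_cancel_right₀ a ht0).symm⟩
end

section
/- Let d ≥ 2, j ∈ F_q, and let S_j ⊆ F_q^d be the sphere of radius j. Then for every m ∈ F_q^d, the Fourier transform of the indicator of S_j satisfies Ŝ_j(m) = q^{−1}·δ_0(m) + q^{−d−1}·η(−1)^d·G^d·Σ_{s ∈ F_q^*} η(s)^d·χ(j·s + ||m||/(4s)), where δ_0(m) = 1 if m is the zero vector and δ_0(m) = 0 otherwise. -/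
open Finset

lemma eta_zero (F : Type) [Field F] [Fintype F] [DecidableEq F] : eta F 0 = 0 := by
  simp [eta]

lemma eta_mul {F : Type} [Field F] [Fintype F] [DecidableEq F] (a b : F) :
    eta F (a * b) = eta F a * eta F b := by
  rw [eta, map_mul, Int.cast_mul, ← eta, ← eta]

lemma eta_mul_self {F : Type} [Field F] [Fintype F] [DecidableEq F] {a : F} (ha : a ≠ 0) :
    eta F a * eta F a = 1 := by
  have h := quadraticChar_sq_one ha
  rw [eta, ← sq]
  exact_mod_cast h

lemma gSum_eq_sum_univ {F : Type} [Field F] [Fintype F] [DecidableEq F] (χ : AddChar F ℂ) :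
    gSum F χ = ∑ s : F, eta F s * χ s := by
  rw [gSum, Finset.sum_filter]
  refine Finset.sum_congr rfl fun s _ => ?_
  by_cases hs : s = 0 <;> simp [hs, eta_zero]

lemma sum_eta_mul_addChar_mul {F : Type} [Field F] [Fintype F] [DecidableEq F]
    (χ : AddChar F ℂ) {a : F} (ha : a ≠ 0) :
    ∑ u : F, eta F u * χ (a * u) = eta F a * gSum F χ := by
  rw [gSum_eq_sum_univ, ← Equiv.sum_comp (Equiv.mulLeft₀ a ha) fun s => eta F s * χ s,
    Finset.mul_sum]
  refine Finset.sum_congr rfl fun u _ => ?_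
  simp only [Equiv.mulLeft₀_apply, eta_mul]
  linear_combination (-(eta F u * χ (a * u))) * eta_mul_self ha

lemma sum_addChar_mul_sq_s4 {F : Type} [Field F] [Fintype F] [DecidableEq F]
    (hF : ringChar F ≠ 2) {χ : AddChar F ℂ} (hχ : χ ≠ 1) {a : F} (ha : a ≠ 0) :
    ∑ y : F, χ (a * y ^ 2) = eta F a * gSum F χ := by
  have hfib : ∑ y : F, χ (a * y ^ 2) = ∑ u : F, (eta F u + 1) * χ (a * u) := by
    rw [← Finset.sum_fiberwise (s := Finset.univ) (g := fun y : F => y ^ 2)]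
    refine Finset.sum_congr rfl fun u _ => ?_
    have hcard : ((Finset.univ.filter fun y : F => y ^ 2 = u).card : ℂ) = eta F u + 1 := by
      have h := quadraticChar_card_sqrts hF u
      rw [Set.toFinset_ofPred] at h
      rw [eta]
      exact_mod_cast h
    rw [← hcard, ← nsmul_eq_mul]
    refine Finset.sum_eq_card_nsmul fun y hy => ?_
    rw [(Finset.mem_filter.1 hy).2]
  have hzero : ∑ u : F, χ (a * u) = 0 := by
    have h := AddChar.sum_mulShift a (AddChar.IsPrimitive.of_ne_one hχ)
    simpa [ha, mul_comm] using h
  simp only [hfib, add_mul, one_mul, Finset.sum_add_distrib, hzero, add_zero]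
  exact sum_eta_mul_addChar_mul χ ha

lemma sum_addChar_quadratic_s4 {F : Type} [Field F] [Fintype F] [DecidableEq F]
    (hF : ringChar F ≠ 2) {χ : AddChar F ℂ} (hχ : χ ≠ 1) {s : F} (hs : s ≠ 0) (b : F) :
    ∑ y : F, χ (-(y * b) - s * y ^ 2)
      = eta F (-1) * eta F s * gSum F χ * χ (b ^ 2 / (4 * s)) := by
  have h2 : (2 : F) ≠ 0 := Ring.two_ne_zero hF
  have h4 : (4 : F) ≠ 0 := by
    have h : (4 : F) = 2 * 2 := by norm_num
    rw [h]
    exact mul_ne_zero h2 h2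
  rw [← eta_mul, neg_one_mul, ← sum_addChar_mul_sq_s4 hF hχ (neg_ne_zero.2 hs),
    ← Equiv.sum_comp (Equiv.addRight (b / (2 * s))) fun y => χ (-s * y ^ 2), Finset.sum_mul]
  refine Finset.sum_congr rfl fun y _ => ?_
  rw [← AddChar.map_add_eq_mul]
  congr 1
  simp only [Equiv.coe_addRight]
  field_simp
  ring

lemma addChar_map_sum {F ι : Type*} [AddCommGroup F] (χ : AddChar F ℂ) (t : Finset ι)
    (f : ι → F) : χ (∑ i ∈ t, f i) = ∏ i ∈ t, χ (f i) :=
  map_prod χ.toMonoidHom (fun i => Multiplicative.ofAdd (f i)) t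

lemma prod_sum_addChar {F : Type} [Field F] [Fintype F] {d : ℕ}
    (χ : AddChar F ℂ) (s : F) (m : Fin d → F) :
    ∑ x : Fin d → F, χ (-(∑ i, x i * m i) - s * nrm x)
      = ∏ i, ∑ y : F, χ (-(y * m i) - s * y ^ 2) := by
  rw [Fintype.prod_sum]
  refine Finset.sum_congr rfl fun x _ => ?_
  rw [← addChar_map_sum, nrm, Finset.mul_sum, ← Finset.sum_neg_distrib,
    ← Finset.sum_sub_distrib]

lemma prod_sum_addChar_neg_mul {F : Type} [Field F] [Fintype F] [DecidableEq F] {d : ℕ}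
    {χ : AddChar F ℂ} (hχ : χ ≠ 1) (m : Fin d → F) :
    ∏ i, ∑ y : F, χ (-(y * m i)) = (Fintype.card F : ℂ) ^ d * (if m = 0 then 1 else 0) := by
  have h (i : Fin d) : ∑ y : F, χ (-(y * m i)) = if m i = 0 then (Fintype.card F : ℂ) else 0 := by
    simpa using AddChar.sum_mulShift (-m i) (AddChar.IsPrimitive.of_ne_one hχ)
  simp only [h]
  split_ifs with hm
  · simp [hm]
  · obtain ⟨i, hi⟩ := Function.ne_iff.1 hm
    rw [mul_zero]
    exact Finset.prod_eq_zero (Finset.mem_univ i) (if_neg hi)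

lemma prod_sum_addChar_quadratic {F : Type} [Field F] [Fintype F] [DecidableEq F]
    (hF : ringChar F ≠ 2) {d : ℕ} {χ : AddChar F ℂ} (hχ : χ ≠ 1) {s : F} (hs : s ≠ 0)
    (m : Fin d → F) :
    ∏ i, ∑ y : F, χ (-(y * m i) - s * y ^ 2)
      = (eta F (-1)) ^ d * (eta F s) ^ d * (gSum F χ) ^ d * χ (nrm m / (4 * s)) := by
  simp only [sum_addChar_quadratic_s4 hF hχ hs, Finset.prod_mul_distrib, Finset.prod_const,
    Finset.card_univ, Fintype.card_fin, nrm, Finset.sum_div, addChar_map_sum]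

lemma sphereFT_eq_sum {F : Type} [Field F] [Fintype F] [DecidableEq F] (d : ℕ)
    {χ : AddChar F ℂ} (hχ : χ ≠ 1) (j : F) (m : Fin d → F) :
    sphereFT d χ j m = (Fintype.card F : ℂ) ^ (-(d : ℤ) - 1)
      * ∑ s : F, χ (j * s) * ∏ i, ∑ y : F, χ (-(y * m i) - s * y ^ 2) := by
  have hq : (Fintype.card F : ℂ) ≠ 0 := by simp
  have hind (x : Fin d → F) : (if nrm x = j then (1 : ℂ) else 0)
      = (Fintype.card F : ℂ)⁻¹ * ∑ s : F, χ (s * (j - nrm x)) := by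
    rw [AddChar.sum_mulShift _ (AddChar.IsPrimitive.of_ne_one hχ)]
    by_cases h : nrm x = j
    · simp [h]
    · simp [h, sub_eq_zero, Ne.symm h]
  simp only [sphereFT, ft, hind, ← prod_sum_addChar, Finset.mul_sum]
  rw [Finset.sum_comm]
  refine Finset.sum_congr rfl fun s _ => Finset.sum_congr rfl fun x _ => ?_
  have hχs : χ (s * (j - nrm x)) = χ (j * s) * χ (-(s * nrm x)) := by
    rw [← AddChar.map_add_eq_mul]
    ring_nf
  rw [zpow_sub_one₀ hq, hχs, sub_eq_add_neg, AddChar.map_add_eq_mul]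
  ring

theorem sphere_ft_formula (F : Type) [Field F] [Fintype F] [DecidableEq F]
    (hq : Odd (Fintype.card F)) (d : ℕ) (hd : 2 ≤ d)
    (χ : AddChar F ℂ) (hχ : χ ≠ 1) (j : F) (m : Fin d → F) :
    sphereFT d χ j m
      = (Fintype.card F : ℂ)⁻¹ * (if m = 0 then 1 else 0)
        + (Fintype.card F : ℂ) ^ (-(d : ℤ) - 1) * (eta F (-1)) ^ d * (gSum F χ) ^ d
          * ∑ s ∈ Finset.univ.filter (fun s : F => s ≠ 0),
              (eta F s) ^ d * χ (j * s + nrm m / (4 * s)) := by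
  have hF : ringChar F ≠ 2 := fun h => by
    have h0 := FiniteField.even_card_iff_char_two.1 h
    have h1 := Nat.odd_iff.1 hq
    omega
  have hq0 : (Fintype.card F : ℂ) ≠ 0 := by simp
  rw [sphereFT_eq_sum d hχ, ← Finset.sum_filter_add_sum_filter_not Finset.univ (fun s : F => s = 0),
    mul_add]
  congr 1
  · simp only [Finset.filter_eq', Finset.mem_univ, if_true, Finset.sum_singleton, mul_zero,
      zero_mul, sub_zero, AddChar.map_zero_eq_one, one_mul, prod_sum_addChar_neg_mul hχ]
    rw [zpow_sub_one₀ hq0, zpow_neg, zpow_natCast]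
    field_simp
  · simp only [Finset.mul_sum]
    refine Finset.sum_congr rfl fun s hs => ?_
    rw [prod_sum_addChar_quadratic hF hχ (Finset.mem_filter.1 hs).2, AddChar.map_add_eq_mul]
    ring
end
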